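/- Under the hypotheses of the bootstrap estimate (σ₂ ∈ C¹ half-periodic with M̃_E := max_{[0,1/2]} |σ₂'|, M_I / M̃_E > (3/ln(13/12))(β/α) with M_I := ∫₀¹ |∂_x σ₁(·,0)| + ∫₀¹ |∂_x σ₃(·,0)|, and z* with ∂_x σ₁(z*,0) = −M_I/4), suppose a C² classical solution (σ₁, σ₃) of the system of weakly nonlinear gas dynamics, 1-periodic in x, exists on ℝ × [0, 6/(α M_I)], and let x₁(t;z) be the C¹ characteristic flow with ∂_t x₁ = α σ₁(x₁, t), x₁(0;z) = z. Then ∂_z x₁(t;z*) ≤ 1 − (α M_I/6) t for all t, and consequently there exists t* ∈ (0, 6/(α M_I)] with ∂_z x₁(t*; z*) = 0; i.e., the 1-characteristics emanating from near z* focus (geometric blow-up) no later than time 6/(α M_I). -/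

import Mathlib

open MeasureTheory Set

/-- Classical solution of the system of weakly nonlinear gas dynamics on
`ℝ × [0,T]`: 1-periodic in `x` and satisfying both equations pointwise
(time derivatives taken within `[0,T]`). -/
def IsClassicalSolution (α β : ℝ) (σ₂ : ℝ → ℝ) (T : ℝ)
    (σ₁ σ₃ : ℝ → ℝ → ℝ) : Prop :=
  (∀ x t, σ₁ (x + 1) t = σ₁ x t) ∧ (∀ x t, σ₃ (x + 1) t = σ₃ x t) ∧
  ∀ x : ℝ, ∀ t ∈ Set.Icc (0 : ℝ) T,
    (derivWithin (fun s => σ₁ x s) (Set.Icc 0 T) t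
        + (α / 2) * deriv (fun y => (σ₁ y t) ^ 2) x
        + (β / 2) * ∫ y in (-1 : ℝ)..1,
            (1 / 2) * deriv σ₂ ((x + y) / 2) * σ₃ y t = 0) ∧
    (derivWithin (fun s => σ₃ x s) (Set.Icc 0 T) t
        - (α / 2) * deriv (fun y => (σ₃ y t) ^ 2) x
        - (β / 2) * ∫ y in (-1 : ℝ)..1,
            (1 / 2) * deriv σ₂ ((x + y) / 2) * σ₁ y t = 0)


theorem aux_param {F F' : ℝ → ℝ → ℝ} (hF : ∀ x, Continuous (F x))
    (hF' : Continuous (fun p : ℝ × ℝ => F' p.1 p.2))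
    (hd : ∀ x t, HasDerivAt (fun y => F y t) (F' x t) x) (a b x₀ : ℝ) :
    HasDerivAt (fun x => ∫ t in a..b, F x t) (∫ t in a..b, F' x₀ t) x₀ := by
  obtain ⟨C, hC⟩ := (((isCompact_Icc (a := x₀ - 1) (b := x₀ + 1)).prod
    (isCompact_uIcc (a := a) (b := b)))).exists_bound_of_continuousOn hF'.continuousOn
  refine (intervalIntegral.hasDerivAt_integral_of_dominated_loc_of_deriv_le
    (F := F) (F' := F') (bound := fun _ => C) (s := Icc (x₀ - 1) (x₀ + 1))
    (Icc_mem_nhds (by linarith) (by linarith)) ?_ ?_ ?_ ?_ ?_ ?_).2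
  · exact Filter.Eventually.of_forall fun x => (hF x).aestronglyMeasurable
  · exact (hF x₀).intervalIntegrable _ _
  · exact (hF'.comp (by fun_prop : Continuous fun t : ℝ => (x₀, t))).aestronglyMeasurable
  · exact Filter.Eventually.of_forall fun t ht x hx => hC (x, t) ⟨hx, uIoc_subset_uIcc ht⟩
  · exact intervalIntegrable_const
  · exact Filter.Eventually.of_forall fun t ht x hx => hd x t

structure C2Data (u ux ut uxx uxt : ℝ → ℝ → ℝ) : Prop where
  cu : Continuous (fun p : ℝ × ℝ => u p.1 p.2)
  cx : Continuous (fun p : ℝ × ℝ => ux p.1 p.2)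
  ct : Continuous (fun p : ℝ × ℝ => ut p.1 p.2)
  cxx : Continuous (fun p : ℝ × ℝ => uxx p.1 p.2)
  cxt : Continuous (fun p : ℝ × ℝ => uxt p.1 p.2)
  dx : ∀ x t, HasDerivAt (fun y => u y t) (ux x t) x
  dt : ∀ x t, HasDerivAt (fun s => u x s) (ut x t) t
  dxx : ∀ x t, HasDerivAt (fun y => ux y t) (uxx x t) x
  dxt : ∀ x t, HasDerivAt (fun s => ux x s) (uxt x t) t
  dtx : ∀ x t, HasDerivAt (fun y => ut y t) (uxt x t) x
  curve : ∀ (X : ℝ → ℝ) (X' t : ℝ), HasDerivAt X X' t →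
    HasDerivAt (fun s => ux (X s) s) (uxx (X t) t * X' + uxt (X t) t) t

theorem aux_dx {f : ℝ × ℝ → ℝ} (hf : Differentiable ℝ f) (x t : ℝ) :
    HasDerivAt (fun y => f (y, t)) (fderiv ℝ f (x, t) (1, 0)) x :=
  (hf (x, t)).hasFDerivAt.comp_hasDerivAt x
    ((hasDerivAt_id x).prodMk (hasDerivAt_const x t))

theorem aux_dt {f : ℝ × ℝ → ℝ} (hf : Differentiable ℝ f) (x t : ℝ) :
    HasDerivAt (fun s => f (x, s)) (fderiv ℝ f (x, t) (0, 1)) t :=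
  (hf (x, t)).hasFDerivAt.comp_hasDerivAt t
    ((hasDerivAt_const t x).prodMk (hasDerivAt_id t))

theorem aux_curve {f : ℝ × ℝ → ℝ} (hf : Differentiable ℝ f) (X : ℝ → ℝ) (X' t : ℝ)
    (hX : HasDerivAt X X' t) :
    HasDerivAt (fun s => f (X s, s))
      (fderiv ℝ f (X t, t) (1, 0) * X' + fderiv ℝ f (X t, t) (0, 1)) t := by
  have h := HasFDerivAt.comp_hasDerivAt (f := fun s => (X s, s)) t (hf (X t, t)).hasFDerivAt
    (hX.prodMk (hasDerivAt_id t))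
  refine h.congr_deriv ?_
  have : ((X', 1) : ℝ × ℝ) = X' • (1, 0) + (0, 1) := by simp
  rw [this, map_add, map_smul, smul_eq_mul, mul_comm]

theorem c2data {u : ℝ → ℝ → ℝ} (h : ContDiff ℝ 2 (fun p : ℝ × ℝ => u p.1 p.2)) :
    ∃ ux ut uxx uxt, C2Data u ux ut uxx uxt := by
  set U : ℝ × ℝ → ℝ := fun p => u p.1 p.2 with hU
  have hd : Differentiable ℝ U := h.differentiable (by norm_num)
  have hf1 : ContDiff ℝ 1 (fderiv ℝ U) := h.fderiv_right (by norm_num)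
  have hx1 : ContDiff ℝ 1 (fun p => fderiv ℝ U p (1, 0)) := hf1.clm_apply contDiff_const
  have ht1 : ContDiff ℝ 1 (fun p => fderiv ℝ U p (0, 1)) := hf1.clm_apply contDiff_const
  have hxd := hx1.differentiable (by norm_num)
  have htd := ht1.differentiable (by norm_num)
  have hsymm : ∀ p, fderiv ℝ (fun p => fderiv ℝ U p (0, 1)) p (1, 0) =
      fderiv ℝ (fun p => fderiv ℝ U p (1, 0)) p (0, 1) := by
    intro p
    have hs : IsSymmSndFDerivAt ℝ U p := h.contDiffAt.isSymmSndFDerivAt (by simp)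
    have hdf := hf1.differentiable (by norm_num) p
    have e : ∀ v w, fderiv ℝ (fun p => fderiv ℝ U p v) p w = fderiv ℝ (fderiv ℝ U) p w v := by
      intro v w
      rw [fderiv_clm_apply hdf (differentiableAt_const v)]
      simp
    rw [e, e]
    exact hs _ _
  refine ⟨fun x t => fderiv ℝ U (x, t) (1, 0), fun x t => fderiv ℝ U (x, t) (0, 1),
    fun x t => fderiv ℝ (fun p => fderiv ℝ U p (1, 0)) (x, t) (1, 0),
    fun x t => fderiv ℝ (fun p => fderiv ℝ U p (1, 0)) (x, t) (0, 1), ?_⟩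
  exact {
    cu := h.continuous
    cx := hx1.continuous
    ct := ht1.continuous
    cxx := (hx1.continuous_fderiv (by norm_num)).clm_apply continuous_const
    cxt := (hx1.continuous_fderiv (by norm_num)).clm_apply continuous_const
    dx := fun x t => aux_dx hd x t
    dt := fun x t => aux_dt hd x t
    dxx := fun x t => aux_dx hxd x t
    dxt := fun x t => aux_dt hxd x t
    dtx := fun x t => by rw [← hsymm]; exact aux_dx htd x t
    curve := fun X X' t hX => aux_curve hxd X X' t hX }

theorem aux_per_deriv {f f' : ℝ → ℝ} {c : ℝ} (hp : ∀ x, f (x + c) = f x)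
    (hd : ∀ x, HasDerivAt f (f' x) x) (x : ℝ) : f' (x + c) = f' x := by
  have h1 : HasDerivAt (fun y => f (y + c)) (f' (x + c)) x := (hd (x + c)).comp_add_const x c
  rw [funext hp] at h1
  exact h1.unique (hd x)

theorem aux_kernel {k f f' : ℝ → ℝ} {M : ℝ} (hk : Continuous k)
    (hkp : ∀ x, k (x + 1 / 2) = k x) (hkM : ∀ x, |k x| ≤ M)
    (hfp : ∀ x, f (x + 1) = f x) (hf : ∀ x, HasDerivAt f (f' x) x) (hf' : Continuous f') :
    ∃ G : ℝ → ℝ, ∀ x,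
      HasDerivAt (fun x => ∫ y in (-1 : ℝ)..1, (1 / 2) * k ((x + y) / 2) * f y) (G x) x ∧
      |G x| ≤ M * ∫ y in (0 : ℝ)..1, |f' y| := by
  have hfc : Continuous f := continuous_iff_continuousAt.2 fun x => (hf x).continuousAt
  have hf'p : ∀ x, f' (x + 1) = f' x := aux_per_deriv hfp hf
  have hM : 0 ≤ M := (abs_nonneg _).trans (hkM 0)
  have key : ∀ x, ∫ y in (-1 : ℝ)..1, (1 / 2) * k ((x + y) / 2) * f y =
      ∫ s in (-1 : ℝ)..1, (1 / 2) * k (s / 2) * f (s - x) := by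
    intro x
    have hper : Function.Periodic (fun s => (1 / 2) * k (s / 2) * f (s - x)) 2 := by
      intro s
      have e1 : k ((s + 2) / 2) = k (s / 2) := by
        rw [show (s + 2) / 2 = s / 2 + 1 / 2 + 1 / 2 by ring, hkp, hkp]
      have e2 : f (s + 2 - x) = f (s - x) := by
        rw [show s + 2 - x = s - x + 1 + 1 by ring, hfp, hfp]
      simp only [e1, e2]
    have h1 := intervalIntegral.integral_comp_add_right (a := -1) (b := 1)
      (fun s => (1 / 2) * k (s / 2) * f (s - x)) x
    have h2 := hper.intervalIntegral_add_eq (-1 + x) (-1)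
    rw [show (-1 + x + 2 : ℝ) = 1 + x by ring, show (-1 + 2 : ℝ) = 1 by norm_num] at h2
    rw [← h2, ← h1]
    refine intervalIntegral.integral_congr fun y _ => ?_
    simp only [add_sub_cancel_right, add_comm x y]
  have per2 : ∀ x, ∫ s in (-1 : ℝ)..1, |f' (s - x)| = 2 * ∫ y in (0 : ℝ)..1, |f' y| := by
    intro x
    have hper : Function.Periodic (fun s => |f' s|) 1 := fun s => by simp only [hf'p]
    have hi : ∀ a b, IntervalIntegrable (fun s => |f' s|) volume a b :=
      fun a b => hf'.abs.intervalIntegrable a b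
    rw [intervalIntegral.integral_comp_sub_right (fun s => |f' s|) x,
      ← intervalIntegral.integral_add_adjacent_intervals (hi (-1 - x) (-1 - x + 1)) (hi _ _)]
    have h1 := hper.intervalIntegral_add_eq (-1 - x) 0
    have h2 := hper.intervalIntegral_add_eq (-1 - x + 1) 0
    rw [show (-1 - x + 1 + 1 : ℝ) = 1 - x by ring] at h2
    rw [h1, h2]; simp only [zero_add]; ring
  refine ⟨fun x => ∫ s in (-1 : ℝ)..1, (1 / 2) * k (s / 2) * (-f' (s - x)), fun x => ⟨?_, ?_⟩⟩
  · rw [funext key]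
    refine aux_param (F := fun x s => (1 / 2) * k (s / 2) * f (s - x))
      (F' := fun x s => (1 / 2) * k (s / 2) * (-f' (s - x))) ?_ ?_ ?_ _ _ _
    · intro x; fun_prop
    · fun_prop
    · intro x s
      have h0 : HasDerivAt (fun y => f (s - y)) (-f' (s - x)) x := (hf (s - x)).comp_const_sub s x
      exact h0.const_mul _
  · calc |∫ s in (-1 : ℝ)..1, (1 / 2) * k (s / 2) * (-f' (s - x))|
        ≤ ∫ s in (-1 : ℝ)..1, |(1 / 2) * k (s / 2) * (-f' (s - x))| :=
          intervalIntegral.abs_integral_le_integral_abs (by norm_num)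
      _ ≤ ∫ s in (-1 : ℝ)..1, M / 2 * |f' (s - x)| := by
          refine intervalIntegral.integral_mono_on (by norm_num) ?_ ?_ ?_
          · apply Continuous.intervalIntegrable; fun_prop
          · apply Continuous.intervalIntegrable; fun_prop
          · intro s _
            rw [abs_mul, abs_mul, abs_neg, abs_of_pos (by norm_num : (0 : ℝ) < 1 / 2)]
            have := hkM (s / 2)
            gcongr
            linarith
      _ = M * ∫ y in (0 : ℝ)..1, |f' y| := by
          rw [intervalIntegral.integral_const_mul, per2]; ring

theorem aux_phi_deriv {f : ℝ → ℝ} {f' x ε : ℝ} (hε : 0 < ε) (hf : HasDerivAt f f' x) :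
    HasDerivAt (fun y => Real.sqrt (f y ^ 2 + ε ^ 2))
      (f x / Real.sqrt (f x ^ 2 + ε ^ 2) * f') x := by
  have h := ((hf.pow 2).add_const (ε ^ 2)).sqrt (by simp only [Pi.pow_apply]; positivity)
  refine h.congr_deriv ?_
  simp only [Pi.pow_apply]
  have : Real.sqrt (f x ^ 2 + ε ^ 2) ≠ 0 := by positivity
  rw [div_mul_eq_mul_div, div_eq_div_iff (mul_ne_zero two_ne_zero this) this]
  norm_num
  ring

theorem aux_energy {u ux ut uxx uxt : ℝ → ℝ → ℝ} (D : C2Data u ux ut uxx uxt)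
    (hp : ∀ x t, u (x + 1) t = u x t) {a ε t B : ℝ} (hε : 0 < ε)
    (hg : ∀ x, |uxt x t + a * (ux x t ^ 2 + u x t * uxx x t)| ≤ B) :
    ∃ F', HasDerivAt (fun τ => ∫ x in (0 : ℝ)..1, Real.sqrt (ux x τ ^ 2 + ε ^ 2)) F' t ∧
      F' ≤ |a| * ε ^ 2 + B := by
  have hφ : ∀ x τ, 0 < Real.sqrt (ux x τ ^ 2 + ε ^ 2) := fun x τ => by positivity
  have cx := D.cx
  have cxt := D.cxt
  have cxx := D.cxx
  have cu := D.cu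
  have cx2 : ∀ τ, Continuous (fun x => ux x τ) := fun τ =>
    cx.comp (by fun_prop : Continuous fun x : ℝ => (x, τ))
  have cu2 : ∀ τ, Continuous (fun x => u x τ) := fun τ =>
    cu.comp (by fun_prop : Continuous fun x : ℝ => (x, τ))
  have cxt2 : ∀ τ, Continuous (fun x => uxt x τ) := fun τ =>
    cxt.comp (by fun_prop : Continuous fun x : ℝ => (x, τ))
  have cxx2 : ∀ τ, Continuous (fun x => uxx x τ) := fun τ =>
    cxx.comp (by fun_prop : Continuous fun x : ℝ => (x, τ))
  have hder : HasDerivAt (fun τ => ∫ x in (0 : ℝ)..1, Real.sqrt (ux x τ ^ 2 + ε ^ 2))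
      (∫ x in (0 : ℝ)..1, ux x t / Real.sqrt (ux x t ^ 2 + ε ^ 2) * uxt x t) t := by
    refine aux_param (F := fun τ x => Real.sqrt (ux x τ ^ 2 + ε ^ 2))
      (F' := fun τ x => ux x τ / Real.sqrt (ux x τ ^ 2 + ε ^ 2) * uxt x τ) ?_ ?_ ?_ _ _ _
    · intro τ
      have := cx2 τ
      fun_prop
    · have h1 : Continuous (fun p : ℝ × ℝ => ux p.2 p.1) := cx.comp continuous_swap
      have h2 : Continuous (fun p : ℝ × ℝ => uxt p.2 p.1) := cxt.comp continuous_swap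
      refine (h1.div ?_ fun p => (hφ p.2 p.1).ne').mul h2
      fun_prop
    · intro τ x
      exact aux_phi_deriv hε (D.dxt x τ)
  refine ⟨_, hder, ?_⟩
  -- total derivative term
  have hE : ∀ x, HasDerivAt (fun y => u y t * Real.sqrt (ux y t ^ 2 + ε ^ 2))
      (ux x t * Real.sqrt (ux x t ^ 2 + ε ^ 2) +
        u x t * (ux x t / Real.sqrt (ux x t ^ 2 + ε ^ 2) * uxx x t)) x := fun x =>
    (D.dx x t).mul (aux_phi_deriv hε (D.dxx x t))
  have cdiv : Continuous (fun x => ux x t / Real.sqrt (ux x t ^ 2 + ε ^ 2)) := by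
    have := cx2 t
    refine this.div ?_ fun x => (hφ x t).ne'
    fun_prop
  have cE : Continuous (fun x => ux x t * Real.sqrt (ux x t ^ 2 + ε ^ 2) +
        u x t * (ux x t / Real.sqrt (ux x t ^ 2 + ε ^ 2) * uxx x t)) := by
    have := cx2 t
    have := cu2 t
    have := cxx2 t
    fun_prop
  have hpx : ∀ x, ux (x + 1) t = ux x t :=
    aux_per_deriv (fun x => hp x t) (fun x => D.dx x t)
  have hE0 : ∫ x in (0 : ℝ)..1, (ux x t * Real.sqrt (ux x t ^ 2 + ε ^ 2) +
        u x t * (ux x t / Real.sqrt (ux x t ^ 2 + ε ^ 2) * uxx x t)) = 0 := by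
    rw [intervalIntegral.integral_eq_sub_of_hasDerivAt (fun x _ => hE x)
      (cE.intervalIntegrable _ _)]
    have h1 := hp 0 t
    have h2 := hpx 0
    rw [zero_add] at h1 h2
    rw [h1, h2, sub_self]
  calc ∫ x in (0 : ℝ)..1, ux x t / Real.sqrt (ux x t ^ 2 + ε ^ 2) * uxt x t
      ≤ ∫ x in (0 : ℝ)..1, ((|a| * ε ^ 2 + B) - a * (ux x t * Real.sqrt (ux x t ^ 2 + ε ^ 2) +
        u x t * (ux x t / Real.sqrt (ux x t ^ 2 + ε ^ 2) * uxx x t))) := by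
        refine intervalIntegral.integral_mono_on (by norm_num) ?_ ?_ ?_
        · exact (cdiv.mul (cxt2 t)).intervalIntegrable _ _
        · exact (continuous_const.sub (continuous_const.mul cE)).intervalIntegrable _ _
        · intro x _
          have hg := hg x
          have hφx := hφ x t
          have hsq : Real.sqrt (ux x t ^ 2 + ε ^ 2) ^ 2 = ux x t ^ 2 + ε ^ 2 :=
            Real.sq_sqrt (by positivity)
          set φ := Real.sqrt (ux x t ^ 2 + ε ^ 2)
          set w := ux x t
          have hr : |w / φ| ≤ 1 := by
            rw [abs_div, abs_of_pos hφx, div_le_one hφx]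
            exact abs_le_of_sq_le_sq (by nlinarith [sq_nonneg ε]) hφx.le
          have hid : w / φ * uxt x t = w / φ * (uxt x t + a * (w ^ 2 + u x t * uxx x t))
              - a * (w * φ + u x t * (w / φ * uxx x t)) + ε ^ 2 * (a * (w / φ)) := by
            have : ε ^ 2 = φ ^ 2 - w ^ 2 := by linarith
            rw [this]
            field_simp
            ring
          rw [hid]
          have b1 : w / φ * (uxt x t + a * (w ^ 2 + u x t * uxx x t)) ≤ B := by
            refine (le_abs_self _).trans ?_
            rw [abs_mul]
            have := mul_le_mul hr hg (abs_nonneg _) zero_le_one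
            linarith
          have b2 : a * (w / φ) ≤ |a| := by
            refine (le_abs_self _).trans ?_
            rw [abs_mul]
            have := mul_le_mul_of_nonneg_left hr (abs_nonneg a)
            linarith
          have b3 := mul_le_mul_of_nonneg_left b2 (sq_nonneg ε)
          linarith
    _ = |a| * ε ^ 2 + B := by
        have ci : Continuous (fun x => a * (ux x t * Real.sqrt (ux x t ^ 2 + ε ^ 2) +
          u x t * (ux x t / Real.sqrt (ux x t ^ 2 + ε ^ 2) * uxx x t))) :=
          continuous_const.mul cE
        rw [intervalIntegral.integral_sub (continuous_const.intervalIntegrable _ _)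
          (ci.intervalIntegrable _ _), intervalIntegral.integral_const_mul, hE0]
        simp

theorem aux_gronwall {F : ℝ → ℝ} {c δ T : ℝ} (hc : 0 < c)
    (hF : ∀ t ∈ Icc 0 T, ∃ F', HasDerivAt F F' t ∧ F' ≤ c * F t + δ) :
    ∀ t ∈ Icc 0 T, F t ≤ (F 0 + δ / c) * Real.exp (c * t) - δ / c := by
  have hd : ∀ t ∈ Icc 0 T, ∃ G', HasDerivAt (fun t => Real.exp (-(c * t)) * (F t + δ / c)) G' t
      ∧ G' ≤ 0 := by
    intro t ht
    obtain ⟨F', h1, h2⟩ := hF t ht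
    have he : HasDerivAt (fun t : ℝ => Real.exp (-(c * t))) (Real.exp (-(c * t)) * (-(c * 1))) t :=
      (((hasDerivAt_id t).const_mul c).neg).exp
    refine ⟨_, he.mul (h1.add_const _), ?_⟩
    have h3 : 0 < Real.exp (-(c * t)) := Real.exp_pos _
    have : Real.exp (-(c * t)) * (-(c * 1)) * (F t + δ / c) + Real.exp (-(c * t)) * F'
      = Real.exp (-(c * t)) * (F' - (c * F t + δ)) := by field_simp; ring
    rw [this]
    exact mul_nonpos_of_nonneg_of_nonpos h3.le (by linarith)
  have hanti : AntitoneOn (fun t => Real.exp (-(c * t)) * (F t + δ / c)) (Icc 0 T) := by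
    refine antitoneOn_of_deriv_nonpos (convex_Icc _ _) ?_ ?_ ?_
    · intro t ht
      obtain ⟨G, h1, -⟩ := hd t ht
      exact h1.continuousAt.continuousWithinAt
    · intro t ht
      obtain ⟨G, h1, -⟩ := hd t (interior_subset ht)
      exact h1.differentiableAt.differentiableWithinAt
    · intro t ht
      obtain ⟨G, h1, h2⟩ := hd t (interior_subset ht)
      rw [h1.deriv]; exact h2
  intro t ht
  have h := hanti ⟨le_rfl, ht.1.trans ht.2⟩ ht ht.1
  simp only [mul_zero, neg_zero, Real.exp_zero, one_mul] at h
  have h3 : 0 < Real.exp (c * t) := Real.exp_pos _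
  have h4 : Real.exp (-(c * t)) * Real.exp (c * t) = 1 := by rw [← Real.exp_add]; simp
  have h5 := mul_le_mul_of_nonneg_right h h3.le
  have h6 : Real.exp (-(c * t)) * (F t + δ / c) * Real.exp (c * t) = F t + δ / c := by
    linear_combination (F t + δ / c) * h4
  linarith

/-- The L¹ bound. -/
theorem aux_L1 {u ux ut uxx uxt v vx vt vxx vxt : ℝ → ℝ → ℝ} (Du : C2Data u ux ut uxx uxt)
    (Dv : C2Data v vx vt vxx vxt) (hpu : ∀ x t, u (x + 1) t = u x t)
    (hpv : ∀ x t, v (x + 1) t = v x t) {a a' c T : ℝ} (hc : 0 < c)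
    (hu : ∀ t ∈ Icc 0 T, ∀ x, |uxt x t + a * (ux x t ^ 2 + u x t * uxx x t)|
      ≤ c * ∫ y in (0 : ℝ)..1, |vx y t|)
    (hv : ∀ t ∈ Icc 0 T, ∀ x, |vxt x t + a' * (vx x t ^ 2 + v x t * vxx x t)|
      ≤ c * ∫ y in (0 : ℝ)..1, |ux y t|) :
    ∀ t ∈ Icc 0 T, (∫ y in (0 : ℝ)..1, |ux y t|) + ∫ y in (0 : ℝ)..1, |vx y t| ≤
      ((∫ y in (0 : ℝ)..1, |ux y 0|) + ∫ y in (0 : ℝ)..1, |vx y 0|) * Real.exp (c * t) := by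
  intro t ht
  have cu : ∀ τ, Continuous (fun x => ux x τ) := fun τ =>
    Du.cx.comp (by fun_prop : Continuous fun x : ℝ => (x, τ))
  have cv : ∀ τ, Continuous (fun x => vx x τ) := fun τ =>
    Dv.cx.comp (by fun_prop : Continuous fun x : ℝ => (x, τ))
  have low : ∀ {f : ℝ → ℝ} (_ : Continuous f) (ε : ℝ),
      ∫ y in (0 : ℝ)..1, |f y| ≤ ∫ y in (0 : ℝ)..1, Real.sqrt (f y ^ 2 + ε ^ 2) := by
    intro f hf ε
    refine intervalIntegral.integral_mono_on (by norm_num) (hf.abs.intervalIntegrable _ _)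
      (Continuous.intervalIntegrable (by fun_prop) _ _) fun x _ => ?_
    exact Real.abs_le_sqrt (by nlinarith [sq_nonneg ε])
  have upp : ∀ {f : ℝ → ℝ} (_ : Continuous f) (ε : ℝ), 0 < ε →
      ∫ y in (0 : ℝ)..1, Real.sqrt (f y ^ 2 + ε ^ 2) ≤ (∫ y in (0 : ℝ)..1, |f y|) + ε := by
    intro f hf ε hε
    have : (∫ y in (0 : ℝ)..1, |f y|) + ε = ∫ y in (0 : ℝ)..1, (|f y| + ε) := by
      rw [intervalIntegral.integral_add (hf.abs.intervalIntegrable _ _)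
        (continuous_const.intervalIntegrable _ _)]
      simp
    rw [this]
    refine intervalIntegral.integral_mono_on (by norm_num)
      (Continuous.intervalIntegrable (by fun_prop) _ _)
      (Continuous.intervalIntegrable (by fun_prop) _ _) fun x _ => ?_
    refine Real.sqrt_le_iff.2 ⟨by positivity, ?_⟩
    have := mul_nonneg (abs_nonneg (f x)) hε.le
    nlinarith [sq_abs (f x)]
  set S0 := (∫ y in (0 : ℝ)..1, |ux y 0|) + ∫ y in (0 : ℝ)..1, |vx y 0| with hS0
  set A := |a| + |a'| with hA
  have hA0 : 0 ≤ A := by positivity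
  have main : ∀ ε ∈ Ioi (0 : ℝ), (∫ y in (0 : ℝ)..1, |ux y t|) + ∫ y in (0 : ℝ)..1, |vx y t| ≤
      (S0 + 2 * ε + A * ε ^ 2 / c) * Real.exp (c * t) := by
    intro ε hε
    have hε : 0 < ε := hε
    have g := aux_gronwall (F := fun τ => (∫ y in (0 : ℝ)..1, Real.sqrt (ux y τ ^ 2 + ε ^ 2)) +
      ∫ y in (0 : ℝ)..1, Real.sqrt (vx y τ ^ 2 + ε ^ 2)) (δ := A * ε ^ 2) (T := T) hc (by
        intro τ hτ
        obtain ⟨F1, h1, h1'⟩ := aux_energy Du hpu hε (hu τ hτ)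
        obtain ⟨F2, h2, h2'⟩ := aux_energy Dv hpv hε (hv τ hτ)
        refine ⟨F1 + F2, h1.add h2, ?_⟩
        have l1 := mul_le_mul_of_nonneg_left (low (cu τ) ε) hc.le
        have l2 := mul_le_mul_of_nonneg_left (low (cv τ) ε) hc.le
        rw [hA]
        linarith) t ht
    have l1 := low (cu t) ε
    have l2 := low (cv t) ε
    have l3 := upp (cu 0) ε hε
    have l4 := upp (cv 0) ε hε
    have l5 : 0 ≤ A * ε ^ 2 / c := by positivity
    refine (add_le_add l1 l2).trans (g.trans ?_)
    refine (sub_le_self _ l5).trans ?_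
    refine mul_le_mul_of_nonneg_right ?_ (Real.exp_pos _).le
    linarith
  have hlim : Filter.Tendsto (fun ε : ℝ => (S0 + 2 * ε + A * ε ^ 2 / c) * Real.exp (c * t))
      (nhdsWithin 0 (Ioi 0)) (nhds (S0 * Real.exp (c * t))) := by
    have : Continuous (fun ε : ℝ => (S0 + 2 * ε + A * ε ^ 2 / c) * Real.exp (c * t)) := by
      fun_prop
    have h := (this.tendsto 0).mono_left (nhdsWithin_le_nhds (s := Ioi (0 : ℝ)))
    simpa using h
  exact ge_of_tendsto hlim (eventually_nhdsWithin_of_forall main)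

theorem aux_focus {J q : ℝ → ℝ} {α M c T : ℝ} (hα : 0 < α) (hM : 0 < M) (hc : 0 < c)
    (hJc : ContinuousOn J (Icc 0 T)) (hqc : ContinuousOn q (Icc 0 T))
    (hJ : ∀ t ∈ Ioo 0 T, HasDerivAt J (α * q t) t)
    (hq : ∀ t ∈ Ioo 0 T, ∃ g, HasDerivAt q (g * J t) t ∧ |g| ≤ c * (M * Real.exp (c * t)))
    (hpos : ∀ t ∈ Icc 0 T, 0 ≤ J t) (hJ0 : J 0 = 1) (hq0 : q 0 = -(M / 4))
    (hexp : Real.exp (c * T) ≤ 13 / 12) :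
    ∀ t ∈ Icc 0 T, J t ≤ 1 - (α * M / 6) * t := by
  have step : ∀ t ∈ Icc 0 T, (∀ s ∈ Ioo 0 t, q s ≤ 0) → q t ≤ -(M / 6) := by
    intro t ht hs
    have sub : Icc 0 t ⊆ Icc 0 T := Icc_subset_Icc_right ht.2
    have subo : Ioo 0 t ⊆ Ioo 0 T := Ioo_subset_Ioo_right ht.2
    have hJa : AntitoneOn J (Icc 0 t) := by
      refine antitoneOn_of_deriv_nonpos (convex_Icc _ _) (hJc.mono sub) ?_ ?_
      · rw [interior_Icc]
        exact fun s h => (hJ s (subo h)).differentiableAt.differentiableWithinAt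
      · rw [interior_Icc]
        intro s h
        rw [(hJ s (subo h)).deriv]
        exact mul_nonpos_of_nonneg_of_nonpos hα.le (hs s h)
    have hJ1 : ∀ s ∈ Icc 0 t, J s ≤ 1 := fun s h => by
      rw [← hJ0]; exact hJa ⟨le_rfl, ht.1⟩ h h.1
    have he : ∀ s, HasDerivAt (fun s : ℝ => M * Real.exp (c * s))
        (c * (M * Real.exp (c * s))) s := fun s => by
      have := (((hasDerivAt_id s).const_mul c).exp).const_mul M
      refine this.congr_deriv ?_
      simp only [id]; ring
    have hqa : AntitoneOn (fun s => q s - M * Real.exp (c * s)) (Icc 0 t) := by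
      refine antitoneOn_of_deriv_nonpos (convex_Icc _ _) ?_ ?_ ?_
      · exact (hqc.mono sub).sub (Continuous.continuousOn (by fun_prop))
      · rw [interior_Icc]
        intro s h
        obtain ⟨g, h1, -⟩ := hq s (subo h)
        exact (h1.sub (he s)).differentiableAt.differentiableWithinAt
      · rw [interior_Icc]
        intro s h
        obtain ⟨g, h1, h2⟩ := hq s (subo h)
        have h3 : HasDerivAt (fun s => q s - M * Real.exp (c * s)) _ s := h1.sub (he s)
        rw [h3.deriv]
        have h4 := hJ1 s ⟨h.1.le, h.2.le⟩
        have h5 := hpos s (sub ⟨h.1.le, h.2.le⟩)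
        have h6 : g * J s ≤ |g| * 1 :=
          (mul_le_mul_of_nonneg_right (le_abs_self g) h5).trans
            (mul_le_mul_of_nonneg_left h4 (abs_nonneg g))
        linarith
    have h := hqa ⟨le_rfl, ht.1⟩ ⟨ht.1, le_rfl⟩ ht.1
    simp only [mul_zero, Real.exp_zero, hq0] at h
    have h7 : Real.exp (c * t) ≤ 13 / 12 :=
      (Real.exp_le_exp.2 (mul_le_mul_of_nonneg_left ht.2 hc.le)).trans hexp
    have h8 := mul_le_mul_of_nonneg_left h7 hM.le
    linarith
  have hneg : ∀ t ∈ Icc 0 T, q t < 0 := by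
    by_contra! hcon
    obtain ⟨t1, ht1, hqt1⟩ := hcon
    set Z := Icc 0 T ∩ q ⁻¹' Ici 0 with hZ
    have hZc : IsClosed Z := hqc.preimage_isClosed_of_isClosed isClosed_Icc isClosed_Ici
    have hZb : BddBelow Z := ⟨0, fun s hs => hs.1.1⟩
    have hmem : sInf Z ∈ Z := hZc.csInf_mem ⟨t1, ht1, hqt1⟩ hZb
    have := step (sInf Z) hmem.1 (by
      intro s hs
      by_contra! h
      have : s ∈ Z := ⟨⟨hs.1.le, hs.2.le.trans hmem.1.2⟩, h.le⟩
      exact absurd (csInf_le hZb this) (not_le.2 hs.2))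
    have h2 : 0 ≤ q (sInf Z) := hmem.2
    linarith
  have hq6 : ∀ t ∈ Icc 0 T, q t ≤ -(M / 6) := fun t ht => step t ht fun s hs =>
    (hneg s ⟨hs.1.le, hs.2.le.trans ht.2⟩).le
  intro t ht
  have hl : ∀ s : ℝ, HasDerivAt (fun s : ℝ => (α * M / 6) * s) (α * M / 6) s := fun s => by
    simpa using (hasDerivAt_id s).const_mul (α * M / 6)
  have hA : AntitoneOn (fun s => J s + (α * M / 6) * s) (Icc 0 T) := by
    refine antitoneOn_of_deriv_nonpos (convex_Icc _ _) ?_ ?_ ?_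
    · exact hJc.add (Continuous.continuousOn (by fun_prop))
    · rw [interior_Icc]
      exact fun s h => ((hJ s h).add (hl s)).differentiableAt.differentiableWithinAt
    · rw [interior_Icc]
      intro s h
      have h3 : HasDerivAt (fun s => J s + (α * M / 6) * s) _ s := (hJ s h).add (hl s)
      rw [h3.deriv]
      have := mul_le_mul_of_nonneg_left (hq6 s ⟨h.1.le, h.2.le⟩) hα.le
      linarith
  have := hA ⟨le_rfl, ht.1.trans ht.2⟩ ht ht.1
  simp only [mul_zero, hJ0] at this
  linarith

theorem aux_J {u ux ut uxx uxt : ℝ → ℝ → ℝ} (D : C2Data u ux ut uxx uxt) {α T : ℝ}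
    {x₁ : ℝ → ℝ → ℝ} (hx : ContDiff ℝ 1 (fun p : ℝ × ℝ => x₁ p.1 p.2))
    (hode : ∀ z : ℝ, ∀ t ∈ Icc (0 : ℝ) T,
      HasDerivWithinAt (fun s => x₁ s z) (α * u (x₁ t z) t) (Icc 0 T) t)
    (h0 : ∀ z, x₁ 0 z = z) (z : ℝ) :
    Continuous (fun t => deriv (fun w => x₁ t w) z) ∧
    deriv (fun w => x₁ 0 w) z = 1 ∧
    (∀ t ∈ Ioo 0 T, HasDerivAt (fun t => deriv (fun w => x₁ t w) z)
      (α * (ux (x₁ t z) t * deriv (fun w => x₁ t w) z)) t) ∧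
    ∀ t ∈ Icc 0 T, 0 ≤ deriv (fun w => x₁ t w) z := by
  have hdiff := hx.differentiable (by norm_num)
  have hxz : ∀ s w, HasDerivAt (fun w => x₁ s w)
      (fderiv ℝ (fun p : ℝ × ℝ => x₁ p.1 p.2) (s, w) (0, 1)) w := fun s w => aux_dt hdiff s w
  have hJc2 : Continuous (fun p : ℝ × ℝ => fderiv ℝ (fun p : ℝ × ℝ => x₁ p.1 p.2) p (0, 1)) :=
    (hx.continuous_fderiv (by norm_num)).clm_apply continuous_const
  have hJe : ∀ s w, deriv (fun w => x₁ s w) w =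
      fderiv ℝ (fun p : ℝ × ℝ => x₁ p.1 p.2) (s, w) (0, 1) := fun s w => (hxz s w).deriv
  have cJ : ∀ w, Continuous (fun t => deriv (fun w => x₁ t w) w) := by
    intro w
    simp only [hJe]
    exact hJc2.comp (by fun_prop : Continuous fun t : ℝ => (t, w))
  have cX : ∀ w, Continuous (fun s => x₁ s w) := fun w =>
    hx.continuous.comp (by fun_prop : Continuous fun t : ℝ => (t, w))
  have cux : Continuous (fun s => ux (x₁ s z) s) := D.cx.comp ((cX z).prodMk continuous_id)
  have hint : ∀ t ∈ Icc 0 T, ∀ w, x₁ t w = w + ∫ s in (0 : ℝ)..t, α * u (x₁ s w) s := by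
    intro t ht w
    have cF : Continuous (fun s => α * u (x₁ s w) s) :=
      continuous_const.mul (D.cu.comp ((cX w).prodMk continuous_id))
    have := intervalIntegral.integral_eq_sub_of_hasDerivAt_of_le ht.1
      (f := fun s => x₁ s w) (f' := fun s => α * u (x₁ s w) s) (cX w).continuousOn
      (fun s hs => (hode w s ⟨hs.1.le, hs.2.le.trans ht.2⟩).hasDerivAt
        (Icc_mem_nhds hs.1 (hs.2.trans_le ht.2))) (cF.intervalIntegrable _ _)
    rw [this, h0]; ring
  have hJint : ∀ t ∈ Icc 0 T, deriv (fun w => x₁ t w) z =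
      1 + ∫ s in (0 : ℝ)..t, α * (ux (x₁ s z) s * deriv (fun w => x₁ s w) z) := by
    intro t ht
    have hp := aux_param (F := fun w s => α * u (x₁ s w) s)
      (F' := fun w s => α * (ux (x₁ s w) s * deriv (fun w => x₁ s w) w)) (by
        intro w
        exact continuous_const.mul (D.cu.comp ((cX w).prodMk continuous_id))) (by
        simp only [hJe]
        have e1 : Continuous (fun p : ℝ × ℝ => x₁ p.2 p.1) := hx.continuous.comp continuous_swap
        exact continuous_const.mul ((D.cx.comp (e1.prodMk continuous_snd)).mul
          (hJc2.comp continuous_swap))) (by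
        intro w s
        have e := (D.dx (x₁ s w) s).comp w (hxz s w)
        rw [hJe]
        exact e.const_mul α) 0 t z
    have h2 : HasDerivAt (fun w => x₁ t w) (1 + ∫ s in (0 : ℝ)..t,
        α * (ux (x₁ s z) s * deriv (fun w => x₁ s w) z)) z := by
      rw [funext (hint t ht)]
      exact (hasDerivAt_id z).add hp
    exact h2.deriv
  have hJ0 : deriv (fun w => x₁ 0 w) z = 1 := by
    rw [funext h0]; exact (hasDerivAt_id z).deriv
  have hJd : ∀ t ∈ Ioo 0 T, HasDerivAt (fun t => deriv (fun w => x₁ t w) z)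
      (α * (ux (x₁ t z) t * deriv (fun w => x₁ t w) z)) t := by
    intro t ht
    have cF : Continuous (fun s => α * (ux (x₁ s z) s * deriv (fun w => x₁ s w) z)) :=
      continuous_const.mul (cux.mul (cJ z))
    have h1 := ((cF.integral_hasStrictDerivAt 0 t).hasDerivAt).const_add 1
    refine h1.congr_of_eventuallyEq ?_
    filter_upwards [Ioo_mem_nhds ht.1 ht.2] with s hs
    exact hJint s ⟨hs.1.le, hs.2.le⟩
  refine ⟨cJ z, hJ0, hJd, ?_⟩
  intro t ht
  have cA : Continuous (fun s => α * ux (x₁ s z) s) := continuous_const.mul cux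
  have hE : ∀ s, HasDerivAt (fun t => Real.exp (-∫ s in (0 : ℝ)..t, α * ux (x₁ s z) s))
      (Real.exp (-∫ r in (0 : ℝ)..s, α * ux (x₁ r z) r) * -(α * ux (x₁ s z) s)) s := fun s =>
    ((cA.integral_hasStrictDerivAt 0 s).hasDerivAt.neg).exp
  have hm : MonotoneOn (fun t => deriv (fun w => x₁ t w) z *
      Real.exp (-∫ s in (0 : ℝ)..t, α * ux (x₁ s z) s)) (Icc 0 T) := by
    refine monotoneOn_of_deriv_nonneg (convex_Icc _ _) ?_ ?_ ?_
    · have : Continuous (fun t => Real.exp (-∫ s in (0 : ℝ)..t, α * ux (x₁ s z) s)) :=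
        continuous_iff_continuousAt.2 fun s => (hE s).continuousAt
      exact ((cJ z).mul this).continuousOn
    · rw [interior_Icc]
      exact fun s h => ((hJd s h).mul (hE s)).differentiableAt.differentiableWithinAt
    · rw [interior_Icc]
      intro s h
      have h3 : HasDerivAt (fun t => deriv (fun w => x₁ t w) z *
        Real.exp (-∫ s in (0 : ℝ)..t, α * ux (x₁ s z) s)) _ s := (hJd s h).mul (hE s)
      rw [h3.deriv]
      apply le_of_eq
      ring
  have := hm ⟨le_rfl, ht.1.trans ht.2⟩ ht ht.1
  simp only [hJ0, intervalIntegral.integral_same, neg_zero, Real.exp_zero, mul_one] at this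
  by_contra! hcon
  have := mul_neg_of_neg_of_pos hcon (Real.exp_pos (-∫ s in (0 : ℝ)..t, α * ux (x₁ s z) s))
  linarith

theorem aux_eq {u ux ut uxx uxt v vx vt vxx vxt : ℝ → ℝ → ℝ} (Du : C2Data u ux ut uxx uxt)
    (Dv : C2Data v vx vt vxx vxt) (hpv : ∀ x t, v (x + 1) t = v x t) {k : ℝ → ℝ} {a b M t : ℝ}
    (hk : Continuous k) (hkp : ∀ x, k (x + 1 / 2) = k x) (hkM : ∀ x, |k x| ≤ M)
    (he : ∀ x, ut x t = -(a * (u x t * ux x t))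
      - b * ∫ y in (-1 : ℝ)..1, (1 / 2) * k ((x + y) / 2) * v y t) (x : ℝ) :
    |uxt x t + a * (ux x t ^ 2 + u x t * uxx x t)| ≤ (|b| * M) * ∫ y in (0 : ℝ)..1, |vx y t| := by
  obtain ⟨G, hG⟩ := aux_kernel hk hkp hkM (fun x => hpv x t) (fun x => Dv.dx x t)
    (Dv.cx.comp (by fun_prop : Continuous fun x : ℝ => (x, t)))
  obtain ⟨h1, h2⟩ := hG x
  have h3 := ((((Du.dx x t).mul (Du.dxx x t)).const_mul a).neg).sub (h1.const_mul b)
  have h4 := Du.dtx x t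
  rw [funext he] at h4
  have h5 := h4.unique h3
  rw [h5]
  have : -(a * (ux x t * ux x t + u x t * uxx x t)) - b * G x +
    a * (ux x t ^ 2 + u x t * uxx x t) = -(b * G x) := by ring
  rw [this, abs_neg, abs_mul, mul_assoc]
  exact mul_le_mul_of_nonneg_left h2 (abs_nonneg b)

/-- geometric focusing of the 1-characteristics.  Under the
hypotheses of the bootstrap estimate, if a `C²` classical solution exists on
`ℝ × [0, 6/(α M_I)]`, then `∂_z x₁(t;z*) ≤ 1 - (α M_I/6) t`, and consequently
the characteristics focus at some `t* ∈ (0, 6/(α M_I)]`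
(`∂_z x₁(t*;z*) = 0`). -/
theorem characteristics_focus
    (α β : ℝ) (hα : 0 < α) (hβ : 0 < β)
    (σ₂ : ℝ → ℝ) (hσ₂C1 : ContDiff ℝ 1 σ₂)
    (hσ₂per : ∀ x, σ₂ (x + 1 / 2) = σ₂ x)
    (ME : ℝ) (hME : IsGreatest ((fun x => |deriv σ₂ x|) '' Set.Icc 0 (1 / 2)) ME)
    (σ₁ σ₃ : ℝ → ℝ → ℝ)
    (h₁C2 : ContDiff ℝ 2 (fun p : ℝ × ℝ => σ₁ p.1 p.2))
    (h₃C2 : ContDiff ℝ 2 (fun p : ℝ × ℝ => σ₃ p.1 p.2))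
    (MI : ℝ)
    (hMI : MI = (∫ x in (0 : ℝ)..1, |deriv (fun y => σ₁ y 0) x|)
        + ∫ x in (0 : ℝ)..1, |deriv (fun y => σ₃ y 0) x|)
    (hMIpos : 0 < MI)
    (hcond : MI / ME > (3 / Real.log (13 / 12)) * (β / α))
    (hsol : IsClassicalSolution α β σ₂ (6 / (α * MI)) σ₁ σ₃)
    (zstar : ℝ) (hzstar : deriv (fun y => σ₁ y 0) zstar = -(MI / 4))
    (x₁ : ℝ → ℝ → ℝ)
    (hx₁C1 : ContDiff ℝ 1 (fun p : ℝ × ℝ => x₁ p.1 p.2))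
    (hx₁ode : ∀ z : ℝ, ∀ t ∈ Set.Icc (0 : ℝ) (6 / (α * MI)),
      HasDerivWithinAt (fun s => x₁ s z) (α * σ₁ (x₁ t z) t)
        (Set.Icc 0 (6 / (α * MI))) t)
    (hx₁init : ∀ z : ℝ, x₁ 0 z = z) :
    (∀ t ∈ Set.Icc (0 : ℝ) (6 / (α * MI)),
      deriv (fun w => x₁ t w) zstar ≤ 1 - (α * MI / 6) * t) ∧
    ∃ tstar ∈ Set.Ioc (0 : ℝ) (6 / (α * MI)),
      deriv (fun w => x₁ tstar w) zstar = 0 := by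
  obtain ⟨ux, ut, uxx, uxt, Du⟩ := c2data h₁C2
  obtain ⟨vx, vt, vxx, vxt, Dv⟩ := c2data h₃C2
  obtain ⟨hp1, hp3, hpde⟩ := hsol
  have hT : 0 < 6 / (α * MI) := by positivity
  set T := 6 / (α * MI) with hTdef
  have hL : 0 < Real.log (13 / 12) := Real.log_pos (by norm_num)
  have hMEpos : 0 < ME := by
    obtain ⟨x, -, hx⟩ := hME.1
    have h0 : 0 ≤ ME := by rw [← hx]; exact abs_nonneg _
    rcases h0.eq_or_lt with h | h
    · rw [← h, div_zero] at hcond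
      have : 0 < (3 / Real.log (13 / 12)) * (β / α) := by positivity
      linarith
    · exact h
  have hk : Continuous (deriv σ₂) := hσ₂C1.continuous_deriv le_rfl
  have hkp : ∀ x, deriv σ₂ (x + 1 / 2) = deriv σ₂ x :=
    aux_per_deriv hσ₂per fun x => (hσ₂C1.differentiable (by norm_num) x).hasDerivAt
  have hkM : ∀ x, |deriv σ₂ x| ≤ ME := by
    intro x
    obtain ⟨y, hy, hxy⟩ := Function.Periodic.exists_mem_Ico₀ (f := deriv σ₂) hkp (by norm_num) x
    rw [hxy]
    exact hME.2 ⟨y, ⟨hy.1, hy.2.le⟩, rfl⟩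
  have hsq : ∀ {u ux ut uxx uxt : ℝ → ℝ → ℝ}, C2Data u ux ut uxx uxt → ∀ x t,
      deriv (fun y => (u y t) ^ 2) x = 2 * (u x t * ux x t) := by
    intro u ux ut uxx uxt D x t
    have h : HasDerivAt (fun y => (u y t) ^ 2) _ x := (D.dx x t).pow 2
    rw [h.deriv]
    norm_num
    ring
  have hdw : ∀ {u ux ut uxx uxt : ℝ → ℝ → ℝ}, C2Data u ux ut uxx uxt → ∀ x, ∀ t ∈ Icc 0 T,
      derivWithin (fun s => u x s) (Icc 0 T) t = ut x t := fun D x t ht =>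
    (D.dt x t).hasDerivWithinAt.derivWithin (uniqueDiffOn_Icc hT t ht)
  set c := β / 2 * ME with hcdef
  have hc : 0 < c := by positivity
  have hu : ∀ t ∈ Icc 0 T, ∀ x, |uxt x t + α * (ux x t ^ 2 + σ₁ x t * uxx x t)|
      ≤ c * ∫ y in (0 : ℝ)..1, |vx y t| := by
    intro t ht x
    have := aux_eq Du Dv hp3 (a := α) (b := β / 2) (t := t) hk hkp hkM (by
      intro x
      have h := (hpde x t ht).1
      rw [hsq Du, hdw Du x t ht] at h
      linarith) x
    rwa [abs_of_pos (by positivity : 0 < β / 2)] at this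
  have hv : ∀ t ∈ Icc 0 T, ∀ x, |vxt x t + (-α) * (vx x t ^ 2 + σ₃ x t * vxx x t)|
      ≤ c * ∫ y in (0 : ℝ)..1, |ux y t| := by
    intro t ht x
    have := aux_eq Dv Du hp1 (a := -α) (b := -(β / 2)) (t := t) hk hkp hkM (by
      intro x
      have h := (hpde x t ht).2
      rw [hsq Dv, hdw Dv x t ht] at h
      linarith) x
    rwa [abs_neg, abs_of_pos (by positivity : 0 < β / 2)] at this
  have hL1 := aux_L1 Du Dv hp1 hp3 hc hu hv
  have hMI' : (∫ y in (0 : ℝ)..1, |ux y 0|) + ∫ y in (0 : ℝ)..1, |vx y 0| = MI := by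
    rw [hMI]
    simp only [(Du.dx _ 0).deriv, (Dv.dx _ 0).deriv]
  rw [hMI'] at hL1
  have hexp : Real.exp (c * T) ≤ 13 / 12 := by
    rw [← Real.le_log_iff_exp_le (by norm_num)]
    rw [gt_iff_lt, div_mul_div_comm, div_lt_div_iff₀ (by positivity) hMEpos] at hcond
    rw [hcdef, hTdef, mul_div_assoc', div_le_iff₀ (by positivity)]
    nlinarith
  obtain ⟨cJ, J0, hJd, Jpos⟩ := aux_J Du hx₁C1 hx₁ode hx₁init zstar
  have cX : Continuous (fun s => x₁ s zstar) :=
    hx₁C1.continuous.comp (by fun_prop : Continuous fun t : ℝ => (t, zstar))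
  have cux : Continuous (fun s => ux (x₁ s zstar) s) := Du.cx.comp (cX.prodMk continuous_id)
  have hmain : ∀ t ∈ Icc 0 T, deriv (fun w => x₁ t w) zstar ≤ 1 - (α * MI / 6) * t := by
    refine aux_focus (J := fun t => deriv (fun w => x₁ t w) zstar)
      (q := fun t => ux (x₁ t zstar) t * deriv (fun w => x₁ t w) zstar) hα hMIpos hc
      cJ.continuousOn (cux.mul cJ).continuousOn hJd ?_ Jpos J0 ?_ hexp
    · intro t ht
      have ht' : t ∈ Icc 0 T := ⟨ht.1.le, ht.2.le⟩
      have hX : HasDerivAt (fun s => x₁ s zstar) (α * σ₁ (x₁ t zstar) t) t :=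
        (hx₁ode zstar t ht').hasDerivAt (Icc_mem_nhds ht.1 ht.2)
      refine ⟨uxt (x₁ t zstar) t + α * (ux (x₁ t zstar) t ^ 2 +
        σ₁ (x₁ t zstar) t * uxx (x₁ t zstar) t), ?_, ?_⟩
      · refine ((Du.curve _ _ t hX).mul (hJd t ht)).congr_deriv ?_
        ring
      · refine (hu t ht' _).trans (mul_le_mul_of_nonneg_left ?_ hc.le)
        refine le_trans ?_ (hL1 t ht')
        have : 0 ≤ ∫ y in (0 : ℝ)..1, |ux y t| :=
          intervalIntegral.integral_nonneg (by norm_num) fun y _ => abs_nonneg _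
        linarith
    · change ux (x₁ 0 zstar) 0 * deriv (fun w => x₁ 0 w) zstar = -(MI / 4)
      rw [J0, hx₁init, mul_one, ← hzstar, (Du.dx zstar 0).deriv]
  refine ⟨hmain, ?_⟩
  have hJT := hmain T ⟨hT.le, le_rfl⟩
  have hz : 1 - (α * MI / 6) * T = 0 := by rw [hTdef]; field_simp; ring
  rw [hz] at hJT
  exact ⟨T, ⟨hT, le_rfl⟩, le_antisymm hJT (Jpos T ⟨hT.le, le_rfl⟩)⟩
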